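/- Let μ ∈ D(P_RCCS) be a distribution and L ⊆ N a finite set of channels containing all channels occurring in μ. Define the observer O_L = Σ_{a∈L} a.ω.0 + Σ_{a∈L} ā.ω.0 and o_L = δ_{O_L}. Then χmay_ω(μ | o_L) = χmay_𝓛(μ) and χfair_ω(μ | o_L) = χfair_𝓛(μ). -/

import Mathlib

open scoped Classical

/-! ## Channels, actions, RCCS terms -/

/-- Channels, drawn from an infinite set. -/
abbrev Chan := ℕ

/-- Actions: input/output labels over channels, the silent action `τ`, and the
distinguished success action `ω` (used only by observers). -/
inductive Act where
  | inp : Chan → Act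
  | out : Chan → Act
  | tau : Act
  | omega : Act
deriving DecidableEq

/-- `α` is an external label, i.e. a member of `𝓛 = N ∪ N̄`. -/
def Act.IsLabel : Act → Prop
  | .inp _ => True
  | .out _ => True
  | _ => False

/-- Complementary labels (for communication). -/
def Act.Comp : Act → Act → Prop := fun x y =>
  ∃ a, (x = .inp a ∧ y = .out a) ∨ (x = .out a ∧ y = .inp a)

/-- `β, β̄ ∉ L`: the action is not blocked by the localization `(L)-`. -/
def Act.Allowed (L : Finset Chan) : Act → Prop
  | .inp a => a ∉ L
  | .out a => a ∉ L
  | _ => True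

/-- Channels occurring in an action. -/
def Act.chans : Act → Finset Chan
  | .inp a => {a}
  | .out a => {a}
  | _ => ∅

/-- RCCS (and RCCS^ω) terms, with de Bruijn indices for process variables.
`sum k acts conts` is the nondeterministic choice `Σ_{i∈I} α_i.T_i` over the
nonempty finite index set `I = Fin (k+1)`, and `oplus k w conts` is the
probabilistic choice `⊕_{i∈I} p_i τ.T_i`. `fix T` is `μX.T` (binding index 0). -/
inductive Tm where
  | nil : Tm
  | var : ℕ → Tm
  | sum : (k : ℕ) → (Fin (k+1) → Act) → (Fin (k+1) → Tm) → Tm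
  | oplus : (k : ℕ) → (Fin (k+1) → ℝ) → (Fin (k+1) → Tm) → Tm
  | par : Tm → Tm → Tm
  | loc : Finset Chan → Tm → Tm
  | fix : Tm → Tm

/-- Substitution `T{P/X}` of a (closed) term `P` for the de Bruijn variable `n`. -/
def Tm.subst (P : Tm) : ℕ → Tm → Tm
  | _, .nil => .nil
  | n, .var m => if m = n then P else .var m
  | n, .sum k a c => .sum k a (fun i => Tm.subst P n (c i))
  | n, .oplus k w c => .oplus k w (fun i => Tm.subst P n (c i))
  | n, .par S T => .par (Tm.subst P n S) (Tm.subst P n T)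
  | n, .loc L T => .loc L (Tm.subst P n T)
  | n, .fix T => .fix (Tm.subst P (n+1) T)

/-- `T` has all its free variables among the first `n` de Bruijn indices.
`ClosedAt 0 T` means `T` is closed; `ClosedAt 1 T` means at most one free variable. -/
def Tm.ClosedAt : ℕ → Tm → Prop
  | _, .nil => True
  | n, .var m => m < n
  | n, .sum _ _ c => ∀ i, Tm.ClosedAt n (c i)
  | n, .oplus _ _ c => ∀ i, Tm.ClosedAt n (c i)
  | n, .par S T => Tm.ClosedAt n S ∧ Tm.ClosedAt n T
  | n, .loc _ T => Tm.ClosedAt n T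
  | n, .fix T => Tm.ClosedAt (n+1) T

/-- The success action `ω` does not occur in `T` (so `T` is a genuine RCCS term). -/
def Tm.NoOmega : Tm → Prop
  | .nil => True
  | .var _ => True
  | .sum _ a c => (∀ i, a i ≠ Act.omega) ∧ (∀ i, Tm.NoOmega (c i))
  | .oplus _ _ c => ∀ i, Tm.NoOmega (c i)
  | .par S T => Tm.NoOmega S ∧ Tm.NoOmega T
  | .loc _ T => Tm.NoOmega T
  | .fix T => Tm.NoOmega T

/-- No probabilistic choice occurs in `T` (so `T` is a CCS term). -/
def Tm.NoOplus : Tm → Prop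
  | .nil => True
  | .var _ => True
  | .sum _ _ c => ∀ i, Tm.NoOplus (c i)
  | .oplus _ _ _ => False
  | .par S T => Tm.NoOplus S ∧ Tm.NoOplus T
  | .loc _ T => Tm.NoOplus T
  | .fix T => Tm.NoOplus T

/-- The channels `N(T)` occurring in a term. -/
def Tm.chans : Tm → Finset Chan
  | .nil => ∅
  | .var _ => ∅
  | .sum _ a c =>
      (Finset.univ.sup fun i => (a i).chans) ∪ (Finset.univ.sup fun i => Tm.chans (c i))
  | .oplus _ _ c => Finset.univ.sup fun i => Tm.chans (c i)
  | .par S T => S.chans ∪ T.chans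
  | .loc L T => L ∪ T.chans
  | .fix T => T.chans

/-- Renaming of channels in an action. -/
def Act.rename (f : Chan → Chan) : Act → Act
  | .inp a => .inp (f a)
  | .out a => .out (f a)
  | x => x

/-- Renaming `T[f]` of the global channels of a term (local channels are untouched). -/
def Tm.rename : (Chan → Chan) → Tm → Tm
  | _, .nil => .nil
  | _, .var m => .var m
  | f, .sum k a c => .sum k (fun i => (a i).rename f) (fun i => Tm.rename f (c i))
  | f, .oplus k w c => .oplus k w (fun i => Tm.rename f (c i))
  | f, .par S T => .par (Tm.rename f S) (Tm.rename f T)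
  | f, .loc L T => .loc L (Tm.rename (fun a => if a ∈ L then a else f a) T)
  | f, .fix T => .fix (Tm.rename f T)

/-- `P` is an RCCS process: closed and without the success action. -/
def Tm.IsProc (P : Tm) : Prop := Tm.ClosedAt 0 P ∧ Tm.NoOmega P

/-- `P` is a CCS process: a process without probabilistic choice. -/
def Tm.IsCCS (P : Tm) : Prop := P.IsProc ∧ Tm.NoOplus P

/-! ## Finitely supported distributions -/

/-- Finitely supported probability distributions on `α`. -/
structure FinDist (α : Type) where
  toFun : α → ℝ
  nonneg : ∀ a, 0 ≤ toFun a
  finite_support : (Function.support toFun).Finite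
  sum_one : ∑ᶠ a, toFun a = 1

namespace FinDist

/-- The probability `μ(φ)` that a predicate (set) `φ` holds under `μ`. -/
noncomputable def mass {α : Type} (μ : FinDist α) (φ : Set α) : ℝ :=
  ∑ᶠ a ∈ φ, μ.toFun a

/-- The Dirac distribution `δ_P`. -/
noncomputable def dirac {α : Type} (P : α) : FinDist α where
  toFun := fun Q => if Q = P then 1 else 0
  nonneg := by intro a; by_cases h : a = P <;> simp [h]
  finite_support := by
    apply Set.Finite.subset (Set.finite_singleton P)
    intro a ha
    by_contra h
    simp only [Set.mem_singleton_iff] at h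
    simp [Function.mem_support, h] at ha
  sum_one := by
    rw [finsum_eq_single _ P (fun b hb => by simp [hb])]
    simp

/-- Pushforward of a finitely supported distribution along a map. -/
noncomputable def map {α β : Type} (g : α → β) (μ : FinDist α) : FinDist β where
  toFun := fun b => ∑ᶠ a ∈ {a | g a = b}, μ.toFun a
  nonneg := by
    intro b
    exact finsum_nonneg fun a => finsum_nonneg fun _ => μ.nonneg a
  finite_support := by
    apply Set.Finite.subset (μ.finite_support.image g)
    intro b hb
    rw [Function.mem_support] at hb
    by_contra h
    apply hb
    apply finsum_mem_eq_zero_of_forall_eq_zero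
    intro a ha
    by_contra ha0
    exact h ⟨a, Function.mem_support.mpr ha0, ha⟩
  sum_one := by
    classical
    set s := μ.finite_support.toFinset with hs
    have hfib : ∀ b : β, (∑ᶠ a ∈ {a | g a = b}, μ.toFun a)
        = ∑ a ∈ s.filter (fun a => g a = b), μ.toFun a := by
      intro b
      apply finsum_mem_eq_sum_of_inter_support_eq
      ext a
      simp only [Set.mem_inter_iff, Set.mem_setOf_eq, Finset.coe_filter,
        Set.Finite.mem_toFinset, Function.mem_support, hs]
      tauto
    have hsub : Function.support (fun b : β => ∑ᶠ a ∈ {a | g a = b}, μ.toFun a) ⊆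
        ↑(s.image g) := by
      intro b hb
      rw [Function.mem_support, hfib] at hb
      obtain ⟨a, ha, hne⟩ := Finset.exists_ne_zero_of_sum_ne_zero hb
      rw [Finset.mem_filter] at ha
      simp only [Finset.coe_image, Set.mem_image, Finset.mem_coe]
      exact ⟨a, ha.1, ha.2⟩
    rw [finsum_eq_finset_sum_of_support_subset _ hsub]
    calc ∑ b ∈ s.image g, ∑ᶠ a ∈ {a | g a = b}, μ.toFun a
        = ∑ b ∈ s.image g, ∑ a ∈ s.filter (fun a => g a = b), μ.toFun a :=
          Finset.sum_congr rfl fun b _ => hfib b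
      _ = ∑ a ∈ s, μ.toFun a :=
          Finset.sum_fiberwise_of_maps_to (fun a ha => Finset.mem_image_of_mem g ha)
            μ.toFun
      _ = 1 := by rw [← finsum_eq_sum μ.toFun μ.finite_support]; exact μ.sum_one

/-- The product of two finitely supported distributions. -/
noncomputable def prod {α β : Type} (μ : FinDist α) (ν : FinDist β) :
    FinDist (α × β) where
  toFun := fun x => μ.toFun x.1 * ν.toFun x.2
  nonneg := fun x => mul_nonneg (μ.nonneg _) (ν.nonneg _)
  finite_support := by
    apply Set.Finite.subset (μ.finite_support.prod ν.finite_support)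
    intro x hx
    rw [Function.mem_support] at hx
    have h := mul_ne_zero_iff.mp hx
    exact ⟨Function.mem_support.mpr h.1, Function.mem_support.mpr h.2⟩
  sum_one := by
    classical
    have hsub : Function.support (fun x : α × β => μ.toFun x.1 * ν.toFun x.2) ⊆
        ↑(μ.finite_support.toFinset ×ˢ ν.finite_support.toFinset) := by
      intro x hx
      rw [Function.mem_support] at hx
      have h := mul_ne_zero_iff.mp hx
      simp only [Finset.coe_product, Set.mem_prod, Set.Finite.coe_toFinset]
      exact ⟨h.1, h.2⟩
    rw [finsum_eq_finset_sum_of_support_subset _ hsub, Finset.sum_product]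
    have h1 : ∑ a ∈ μ.finite_support.toFinset, μ.toFun a = 1 := by
      rw [← finsum_eq_sum μ.toFun μ.finite_support]; exact μ.sum_one
    have h2 : ∑ b ∈ ν.finite_support.toFinset, ν.toFun b = 1 := by
      rw [← finsum_eq_sum ν.toFun ν.finite_support]; exact ν.sum_one
    calc ∑ a ∈ μ.finite_support.toFinset, ∑ b ∈ ν.finite_support.toFinset,
          μ.toFun a * ν.toFun b
        = ∑ a ∈ μ.finite_support.toFinset, μ.toFun a * 1 := by
          refine Finset.sum_congr rfl fun a _ => ?_
          rw [← Finset.mul_sum, h2]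
      _ = 1 := by simpa using h1

/-- Parallel composition `μ | ν` of distributions:
`(μ|ν)(A|B) = μ(A)·ν(B)`. -/
noncomputable def parD (μ ν : FinDist Tm) : FinDist Tm :=
  (μ.prod ν).map fun x => Tm.par x.1 x.2

/-- Localization `(L)μ` of a distribution. -/
noncomputable def locD (L : Finset Chan) (μ : FinDist Tm) : FinDist Tm :=
  μ.map (Tm.loc L)

/-- Renaming `μ[f]` of a distribution. -/
noncomputable def renameD (f : Chan → Chan) (μ : FinDist Tm) : FinDist Tm :=
  μ.map (Tm.rename f)

/-- Instantiation `ϑ[P]` of a 1-ary distribution `ϑ` at the process `P`. -/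
noncomputable def instD (ϑ : FinDist Tm) (P : Tm) : FinDist Tm :=
  ϑ.map (fun T => Tm.subst P 0 T)

/-- Every element of the support is a process (`μ ∈ D(P_RCCS)`). -/
def IsProcDist (μ : FinDist Tm) : Prop := ∀ P, μ.toFun P ≠ 0 → P.IsProc

/-- All channels occurring in (the support of) `μ` lie in `L`. -/
def chansIn (μ : FinDist Tm) (L : Finset Chan) : Prop :=
  ∀ P, μ.toFun P ≠ 0 → P.chans ⊆ L

/-- The channel `a` occurs in (the support of) `μ`, i.e. `a ∈ N(μ)`. -/
def hasChan (μ : FinDist Tm) (a : Chan) : Prop := ∃ P, μ.toFun P ≠ 0 ∧ a ∈ P.chans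

end FinDist

/-! ## Part I: the probabilistic labelled transition system on processes -/

/-- Part I of the pLTS for RCCS (and RCCS^ω): `P →α ρ`. -/
inductive Step : Tm → Act → FinDist Tm → Prop where
  | choice {k : ℕ} (acts : Fin (k+1) → Act) (conts : Fin (k+1) → Tm) (i : Fin (k+1)) :
      Step (.sum k acts conts) (acts i) (FinDist.dirac (conts i))
  | oplus {k : ℕ} (w : Fin (k+1) → ℝ) (conts : Fin (k+1) → Tm) (ρ : FinDist Tm) :
      (∀ i, 0 < w i ∧ w i < 1) →
      (∀ Q, ρ.toFun Q = ∑ i, if conts i = Q then w i else 0) →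
      Step (.oplus k w conts) .tau ρ
  | parL {S : Tm} {α : Act} {ρ : FinDist Tm} (T : Tm) :
      Step S α ρ → Step (.par S T) α (ρ.parD (FinDist.dirac T))
  | parR {T : Tm} {α : Act} {ρ : FinDist Tm} (S : Tm) :
      Step T α ρ → Step (.par S T) α ((FinDist.dirac S).parD ρ)
  | comm {S T : Tm} {ℓ1 ℓ2 : Act} {ρ1 ρ2 : FinDist Tm} :
      Act.Comp ℓ1 ℓ2 → Step S ℓ1 ρ1 → Step T ℓ2 ρ2 →
      Step (.par S T) .tau (ρ1.parD ρ2)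
  | loc {T : Tm} {β : Act} {ρ : FinDist Tm} (L : Finset Chan) :
      Step T β ρ → Act.Allowed L β → Step (.loc L T) β (FinDist.locD L ρ)
  | fixp {T : Tm} {β : Act} {ρ : FinDist Tm} :
      Step (Tm.subst (.fix T) 0 T) β ρ → Step (.fix T) β ρ

/-! ## Part II: probabilistic transitions on distributions -/

/-- Part II of the pLTS: `μ →(α,p) ν` iff `0 < p ≤ 1` and there are `P ∈ supp μ`
and `ρ` with `P →α ρ` and `ν = μ + μ(P)·p·(ρ − δ_P)`. -/
def PStep (μ : FinDist Tm) (α : Act) (p : ℝ) (ν : FinDist Tm) : Prop :=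
  0 < p ∧ p ≤ 1 ∧
    ∃ P ρ, 0 < μ.toFun P ∧ Step P α ρ ∧
      ∀ Q, ν.toFun Q = μ.toFun Q + μ.toFun P * p * (ρ.toFun Q - (if Q = P then 1 else 0))

/-- Probabilistic transition sequence `μ →π ν` along a word `π`. -/
def PSeq : FinDist Tm → List (Act × ℝ) → FinDist Tm → Prop
  | μ, [], ν => ν = μ
  | μ, s :: π, ν => ∃ μ', PStep μ s.1 s.2 μ' ∧ PSeq μ' π ν

/-- Internal transition sequence `μ ⇝ ν`. -/
def Internal (μ ν : FinDist Tm) : Prop :=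
  ∃ π : List (Act × ℝ), (∀ s ∈ π, s.1 = Act.tau) ∧ PSeq μ π ν

/-! ## Observability predicates and testing characteristics -/

/-- `ψ_𝓛`: processes that can immediately perform an external action. -/
def psiL : Set Tm := {P | ∃ α ρ, Act.IsLabel α ∧ Step P α ρ}

/-- `ψ_ω`: processes that can immediately perform the success action `ω`. -/
def psiOmega : Set Tm := {P | ∃ ρ, Step P Act.omega ρ}

/-- The may characteristic `χmay_𝓛(μ) = sup { ν(ψ_𝓛) : μ ⇝ ν }`. -/
noncomputable def chiMayL (μ : FinDist Tm) : ℝ :=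
  sSup {x | ∃ ν, Internal μ ν ∧ x = ν.mass psiL}

/-- The fair characteristic `χfair_𝓛(μ) = inf { χmay_𝓛(ν) : μ ⇝ ν }`. -/
noncomputable def chiFairL (μ : FinDist Tm) : ℝ :=
  sInf {x | ∃ ν, Internal μ ν ∧ x = chiMayL ν}

/-- `χmay_ω(μ) = sup { ν(ψ_ω) : μ ⇝ ν }`. -/
noncomputable def chiMayOmega (μ : FinDist Tm) : ℝ :=
  sSup {x | ∃ ν, Internal μ ν ∧ x = ν.mass psiOmega}

/-- `χfair_ω(μ) = inf { χmay_ω(ν) : μ ⇝ ν }`. -/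
noncomputable def chiFairOmega (μ : FinDist Tm) : ℝ :=
  sInf {x | ∃ ν, Internal μ ν ∧ x = chiMayOmega ν}

/-! ## Testing contexts, equipollence, extensionality, diamond/box equivalences -/

/-- `Δ(P_CCS) ⊆ 𝒟 ⊆ D(P_RCCS)`, closed under parallel composition, localization
and (finite-domain) renaming. -/
structure IsTestingContext (D : Set (FinDist Tm)) : Prop where
  dirac_ccs : ∀ P : Tm, P.IsCCS → FinDist.dirac P ∈ D
  proc_dist : ∀ μ ∈ D, μ.IsProcDist
  closed_par : ∀ μ ∈ D, ∀ ν ∈ D, μ.parD ν ∈ D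
  closed_loc : ∀ μ ∈ D, ∀ L : Finset Chan, FinDist.locD L μ ∈ D
  closed_rename : ∀ μ ∈ D, ∀ f : Chan → Chan, {a | f a ≠ a}.Finite →
      FinDist.renameD f μ ∈ D

/-- `R` is probabilistically equipollent. -/
def Equipollent (R : FinDist Tm → FinDist Tm → Prop) : Prop :=
  ∀ μ1 μ2, R μ1 μ2 → chiMayL μ1 = chiMayL μ2

/-- `R` is probabilistically strongly equipollent. -/
def StronglyEquipollent (R : FinDist Tm → FinDist Tm → Prop) : Prop :=
  ∀ μ1 μ2, R μ1 μ2 → chiFairL μ1 = chiFairL μ2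

/-- `R` is `𝒟`-extensional. -/
def DExtensional (D : Set (FinDist Tm)) (R : FinDist Tm → FinDist Tm → Prop) : Prop :=
  ∀ μ1 μ2, R μ1 μ2 →
    (∀ ν ∈ D, R (μ1.parD ν) (μ2.parD ν)) ∧
    (∀ L : Finset Chan, R (FinDist.locD L μ1) (FinDist.locD L μ2))

/-- The `𝒟`-diamond equivalence `=◇^𝒟`, the largest probabilistically equipollent
`𝒟`-extensional relation. -/
def DiamondEq (D : Set (FinDist Tm)) (μ1 μ2 : FinDist Tm) : Prop :=
  ∃ R, Equipollent R ∧ DExtensional D R ∧ R μ1 μ2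

/-- The `𝒟`-box equivalence `=□^𝒟`, the largest probabilistically strongly
equipollent `𝒟`-extensional relation. -/
def BoxEq (D : Set (FinDist Tm)) (μ1 μ2 : FinDist Tm) : Prop :=
  ∃ R, StronglyEquipollent R ∧ DExtensional D R ∧ R μ1 μ2

/-! ## Probabilistic strong bisimulation and lifting -/

/-- Lifting of a relation on processes to distributions, matching the decomposition
`ρ1 = Σ_i p_i δ_{A_i}`, `ρ2 = Σ_i p_i δ_{B_i}` with `A_i R B_i`. -/
def RelLift (R : Tm → Tm → Prop) (ρ1 ρ2 : FinDist Tm) : Prop :=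
  ∃ (k : ℕ) (p : Fin (k+1) → ℝ) (A B : Fin (k+1) → Tm),
    (∀ i, 0 ≤ p i) ∧
    (∀ Q, ρ1.toFun Q = ∑ i, if A i = Q then p i else 0) ∧
    (∀ Q, ρ2.toFun Q = ∑ i, if B i = Q then p i else 0) ∧
    (∀ i, R (A i) (B i))

/-- `R` is a probabilistic strong bisimulation. -/
def IsStrongBisim (R : Tm → Tm → Prop) : Prop :=
  ∀ P Q, R P Q →
    (∀ α ρ, Step P α ρ → ∃ ρ', Step Q α ρ' ∧ RelLift R ρ ρ') ∧
    (∀ α ρ, Step Q α ρ → ∃ ρ', Step P α ρ' ∧ RelLift R ρ ρ')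

/-- `∼p`, the largest probabilistic strong bisimulation. -/
def StrongBisim (P Q : Tm) : Prop := ∃ R, IsStrongBisim R ∧ R P Q

/-- Lifting `E†` of an equivalence on processes to distributions: agreement on the
mass of every equivalence class. -/
def EqLift (E : Tm → Tm → Prop) (μ1 μ2 : FinDist Tm) : Prop :=
  ∀ P, μ1.mass {Q | E P Q} = μ2.mass {Q | E P Q}

/-- Single-branch prefix `α.T`. -/
def Tm.prefix1 (α : Act) (T : Tm) : Tm := Tm.sum 0 (fun _ => α) (fun _ => T)

/-- The observer `O_L = Σ_{a∈L} a.ω.0 + Σ_{a∈L} ā.ω.0` (the empty sum is `0`). -/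
noncomputable def obsO (L : Finset Chan) : Tm :=
  if hL : L = ∅ then Tm.nil
  else
    Tm.sum (2 * L.card - 1)
      (fun i =>
        if h : (i : ℕ) < L.card then
          Act.inp (L.toList.get ⟨(i : ℕ), by rw [Finset.length_toList]; exact h⟩)
        else
          Act.out (L.toList.get ⟨(i : ℕ) - L.card, by
            rw [Finset.length_toList]
            have hc : 0 < L.card :=
              Finset.card_pos.mpr (Finset.nonempty_iff_ne_empty.mpr hL)
            have hi := i.isLt
            omega⟩))
      (fun _ => Tm.prefix1 .omega .nil)

/-! ## Helper material -/

namespace ObsProof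

theorem FinDist_ext {α : Type} {μ ν : FinDist α} (h : ∀ a, μ.toFun a = ν.toFun a) : μ = ν := by
  cases μ; cases ν
  have : _ = _ := funext h
  simp only at this
  subst this
  rfl

theorem parD_ne {μ ν : FinDist Tm} {R : Tm} (h : (μ.parD ν).toFun R ≠ 0) :
    ∃ A B, R = Tm.par A B ∧ μ.toFun A ≠ 0 ∧ ν.toFun B ≠ 0 := by
  by_contra hc
  apply h
  apply finsum_mem_eq_zero_of_forall_eq_zero
  rintro ⟨A, B⟩ hAB
  by_contra h0
  have h1 := mul_ne_zero_iff.mp h0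
  exact hc ⟨A, B, hAB.symm, h1.1, h1.2⟩

theorem parD_par (μ ν : FinDist Tm) (A B : Tm) :
    (μ.parD ν).toFun (Tm.par A B) = μ.toFun A * ν.toFun B := by
  show (∑ᶠ x ∈ {x : Tm × Tm | Tm.par x.1 x.2 = Tm.par A B}, μ.toFun x.1 * ν.toFun x.2) = _
  have : {x : Tm × Tm | Tm.par x.1 x.2 = Tm.par A B} = {(A, B)} := by
    ext ⟨a, b⟩
    simp
  rw [this, finsum_mem_singleton]

theorem locD_ne {μ : FinDist Tm} {L : Finset Chan} {R : Tm} (h : (μ.locD L).toFun R ≠ 0) :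
    ∃ A, R = Tm.loc L A ∧ μ.toFun A ≠ 0 := by
  by_contra hc
  apply h
  apply finsum_mem_eq_zero_of_forall_eq_zero
  intro A hA
  by_contra h0
  exact hc ⟨A, hA.symm, h0⟩

theorem dirac_ne {A B : Tm} (h : (FinDist.dirac A).toFun B ≠ 0) : B = A := by
  by_contra hc
  exact h (if_neg hc)

theorem dirac_self (A : Tm) : (FinDist.dirac A).toFun A = 1 := if_pos rfl

theorem dirac_other {A B : Tm} (h : B ≠ A) : (FinDist.dirac A).toFun B = 0 := if_neg h

theorem toFun_le_one {α : Type} (μ : FinDist α) (a : α) : μ.toFun a ≤ 1 := by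
  rw [← μ.sum_one]
  exact single_le_finsum a μ.finite_support μ.nonneg

/-- The one-step update of a distribution. -/
noncomputable def upd (μ : FinDist Tm) (P : Tm) (p : ℝ) (hp : 0 ≤ p) (hp1 : p ≤ 1)
    (ρ : FinDist Tm) : FinDist Tm where
  toFun := fun Q => μ.toFun Q + μ.toFun P * p * (ρ.toFun Q - (if Q = P then 1 else 0))
  nonneg := by
    intro Q
    have h1 := μ.nonneg Q
    have h2 := μ.nonneg P
    have h3 := ρ.nonneg Q
    by_cases h : Q = P
    · subst h
      simp only [if_true]
      nlinarith [mul_nonneg (mul_nonneg h2 hp) h3, mul_nonneg h2 (sub_nonneg.mpr hp1)]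
    · simp only [h, if_false, sub_zero]
      positivity
  finite_support := by
    apply Set.Finite.subset ((μ.finite_support.union ρ.finite_support).union
      (Set.finite_singleton P))
    intro Q hQ
    by_contra hc
    simp only [Set.mem_union, Function.mem_support, Set.mem_singleton_iff, not_or,
      not_not] at hc
    apply hQ
    simp [hc.1.1, hc.1.2, hc.2]
  sum_one := by
    have hd : (Function.support (FinDist.dirac P).toFun).Finite := (FinDist.dirac P).finite_support
    have hfin : (Function.support fun Q => ρ.toFun Q - (FinDist.dirac P).toFun Q).Finite :=
      (ρ.finite_support.union hd).subset (Function.support_sub _ _)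
    have hfin2 : (Function.support fun Q => μ.toFun P * p *
        (ρ.toFun Q - (FinDist.dirac P).toFun Q)).Finite :=
      hfin.subset (by
        intro Q hQ
        exact right_ne_zero_of_mul hQ)
    show ∑ᶠ Q, (μ.toFun Q + μ.toFun P * p * (ρ.toFun Q - (FinDist.dirac P).toFun Q)) = 1
    rw [finsum_add_distrib μ.finite_support hfin2, ← mul_finsum,
      finsum_sub_distrib ρ.finite_support hd, μ.sum_one, ρ.sum_one, (FinDist.dirac P).sum_one]
    ring

/-! ### Internal sequences -/

def TStep (μ ν : FinDist Tm) : Prop := ∃ p, PStep μ Act.tau p ν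

theorem internal_iff {μ ν : FinDist Tm} : Internal μ ν ↔ Relation.ReflTransGen TStep μ ν := by
  constructor
  · rintro ⟨π, hπ, h⟩
    induction π generalizing μ with
    | nil => cases h; exact .refl
    | cons s π ih =>
      obtain ⟨μ', h1, h2⟩ := h
      have hs : s.1 = Act.tau := hπ s (by simp)
      rw [hs] at h1
      exact Relation.ReflTransGen.head ⟨_, h1⟩ (ih (fun t ht => hπ t (by simp [ht])) h2)
  · intro h
    induction h using Relation.ReflTransGen.head_induction_on with
    | refl => exact ⟨[], by simp, rfl⟩
    | head h1 _ ih =>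
      obtain ⟨p, hp⟩ := h1
      obtain ⟨π, hπ, h⟩ := ih
      refine ⟨(Act.tau, p) :: π, ?_, _, hp, h⟩
      intro s hs
      rcases List.mem_cons.mp hs with rfl | hs
      · rfl
      · exact hπ s hs

/-! ### Good processes -/

def Good (L : Finset Chan) (P : Tm) : Prop := P.NoOmega ∧ P.chans ⊆ L

theorem subst_noOmega {P : Tm} (hP : P.NoOmega) (T : Tm) : ∀ n, T.NoOmega →
    (Tm.subst P n T).NoOmega := by
  induction T with
  | nil => intro n h; exact h
  | var m =>
    intro n _
    unfold Tm.subst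
    split_ifs
    · exact hP
    · trivial
  | sum k a c ih => intro n h; exact ⟨h.1, fun i => ih i n (h.2 i)⟩
  | oplus k w c ih => intro n h; exact fun i => ih i n (h i)
  | par S T ihS ihT => intro n h; exact ⟨ihS n h.1, ihT n h.2⟩
  | loc L T ih => intro n h; exact ih n h
  | fix T ih => intro n h; exact ih (n+1) h

theorem sum_chans {L : Finset Chan} {k : ℕ} {a : Fin (k+1) → Act} {c : Fin (k+1) → Tm} :
    (Tm.sum k a c).chans ⊆ L ↔ (∀ i, (a i).chans ⊆ L) ∧ ∀ i, (c i).chans ⊆ L := by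
  show (Finset.univ.sup fun i => (a i).chans) ∪ (Finset.univ.sup fun i => Tm.chans (c i)) ⊆ L ↔ _
  rw [Finset.union_subset_iff]
  simp only [Finset.sup_le_iff, Finset.mem_univ, true_implies]

theorem oplus_chans {L : Finset Chan} {k : ℕ} {w : Fin (k+1) → ℝ} {c : Fin (k+1) → Tm} :
    (Tm.oplus k w c).chans ⊆ L ↔ ∀ i, (c i).chans ⊆ L := by
  show (Finset.univ.sup fun i => Tm.chans (c i)) ⊆ L ↔ _
  simp only [Finset.sup_le_iff, Finset.mem_univ, true_implies]

theorem subst_chans {L : Finset Chan} {P : Tm} (hP : P.chans ⊆ L) (T : Tm) : ∀ n, T.chans ⊆ L →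
    (Tm.subst P n T).chans ⊆ L := by
  induction T with
  | nil => intro n h; exact h
  | var m =>
    intro n h
    unfold Tm.subst
    split_ifs
    · exact hP
    · exact h
  | sum k a c ih =>
    intro n h
    rw [sum_chans] at h
    exact sum_chans.mpr ⟨h.1, fun i => ih i n (h.2 i)⟩
  | oplus k w c ih =>
    intro n h
    rw [oplus_chans] at h
    exact oplus_chans.mpr fun i => ih i n (h i)
  | par S T ihS ihT =>
    intro n h
    have h' := Finset.union_subset_iff.mp h
    exact Finset.union_subset (ihS n h'.1) (ihT n h'.2)
  | loc L' T ih =>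
    intro n h
    have h' := Finset.union_subset_iff.mp h
    exact Finset.union_subset h'.1 (ih n h'.2)
  | fix T ih => intro n h; exact ih (n+1) h

theorem good_par {L : Finset Chan} {S T : Tm} : Good L (.par S T) ↔ Good L S ∧ Good L T := by
  unfold Good
  show (S.NoOmega ∧ T.NoOmega) ∧ S.chans ∪ T.chans ⊆ L ↔ _
  rw [Finset.union_subset_iff]
  tauto

theorem good_step {L : Finset Chan} {P : Tm} {α : Act} {ρ : FinDist Tm} (h : Step P α ρ) :
    Good L P → α ≠ .omega ∧ α.chans ⊆ L ∧ ∀ Q, ρ.toFun Q ≠ 0 → Good L Q := by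
  induction h with
  | choice acts conts i =>
    rintro ⟨h1, h2⟩
    rw [sum_chans] at h2
    refine ⟨h1.1 i, h2.1 i, fun Q hQ => ?_⟩
    rw [dirac_ne hQ]
    exact ⟨h1.2 i, h2.2 i⟩
  | oplus w conts ρ hw hρ =>
    rintro ⟨h1, h2⟩
    rw [oplus_chans] at h2
    refine ⟨by simp, by simp [Act.chans], fun Q hQ => ?_⟩
    rw [hρ] at hQ
    obtain ⟨i, _, hi⟩ := Finset.exists_ne_zero_of_sum_ne_zero hQ
    have : conts i = Q := by
      by_contra hc
      exact hi (if_neg hc)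
    rw [← this]
    exact ⟨h1 i, h2 i⟩
  | parL T hs ih =>
    intro hg
    rw [good_par] at hg
    obtain ⟨i1, i2, i3⟩ := ih hg.1
    refine ⟨i1, i2, fun Q hQ => ?_⟩
    obtain ⟨A, B, rfl, hA, hB⟩ := parD_ne hQ
    rw [dirac_ne hB]
    exact good_par.mpr ⟨i3 A hA, hg.2⟩
  | parR S hs ih =>
    intro hg
    rw [good_par] at hg
    obtain ⟨i1, i2, i3⟩ := ih hg.2
    refine ⟨i1, i2, fun Q hQ => ?_⟩
    obtain ⟨A, B, rfl, hA, hB⟩ := parD_ne hQ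
    rw [dirac_ne hA]
    exact good_par.mpr ⟨hg.1, i3 B hB⟩
  | comm hc hs ht ihs iht =>
    intro hg
    rw [good_par] at hg
    refine ⟨by simp, by simp [Act.chans], fun Q hQ => ?_⟩
    obtain ⟨A, B, rfl, hA, hB⟩ := parD_ne hQ
    exact good_par.mpr ⟨(ihs hg.1).2.2 A hA, (iht hg.2).2.2 B hB⟩
  | loc L' hs hall ih =>
    rintro ⟨h1, h2⟩
    have h' := Finset.union_subset_iff.mp h2
    obtain ⟨i1, i2, i3⟩ := ih ⟨h1, h'.2⟩
    refine ⟨i1, i2, fun Q hQ => ?_⟩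
    obtain ⟨A, rfl, hA⟩ := locD_ne hQ
    exact ⟨(i3 A hA).1, Finset.union_subset h'.1 (i3 A hA).2⟩
  | fixp hs ih =>
    intro hg
    exact ih ⟨subst_noOmega hg.1 _ _ hg.1, subst_chans hg.2 _ _ hg.2⟩

/-! ### The observer -/

abbrev W : Tm := Tm.prefix1 .omega .nil

theorem step_W {α : Act} {ρ : FinDist Tm} (h : Step W α ρ) : α = .omega := by
  unfold W Tm.prefix1 at h
  cases h
  rfl

theorem W_step : Step W .omega (FinDist.dirac .nil) :=
  Step.choice (fun _ => Act.omega) (fun _ => Tm.nil) 0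

theorem step_obs {L : Finset Chan} {α : Act} {ρ : FinDist Tm} (h : Step (obsO L) α ρ) :
    α.IsLabel ∧ ρ = FinDist.dirac W := by
  unfold obsO at h
  split_ifs at h with hL
  · cases h
  · cases h
    refine ⟨?_, rfl⟩
    dsimp only
    split_ifs <;> trivial

theorem obs_inp {L : Finset Chan} {a : Chan} (ha : a ∈ L) :
    Step (obsO L) (.inp a) (FinDist.dirac W) := by
  have hL : L ≠ ∅ := by rintro rfl; simp at ha
  unfold obsO
  rw [dif_neg hL]
  have ha' := Finset.mem_toList.mpr ha
  obtain ⟨⟨n, hn⟩, hget⟩ := List.mem_iff_get.mp ha'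
  have hn' : n < L.card := by rwa [Finset.length_toList] at hn
  have := @Step.choice (2 * L.card - 1) (fun i =>
        if h : (i : ℕ) < L.card then
          Act.inp (L.toList.get ⟨(i : ℕ), by rw [Finset.length_toList]; exact h⟩)
        else
          Act.out (L.toList.get ⟨(i : ℕ) - L.card, by
            rw [Finset.length_toList]
            have hc : 0 < L.card :=
              Finset.card_pos.mpr (Finset.nonempty_iff_ne_empty.mpr hL)
            have hi := i.isLt
            omega⟩)) (fun _ => Tm.prefix1 .omega .nil) ⟨n, by omega⟩
  simp only [dif_pos hn', hget] at this
  exact this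

theorem obs_out {L : Finset Chan} {a : Chan} (ha : a ∈ L) :
    Step (obsO L) (.out a) (FinDist.dirac W) := by
  have hL : L ≠ ∅ := by rintro rfl; simp at ha
  unfold obsO
  rw [dif_neg hL]
  have ha' := Finset.mem_toList.mpr ha
  obtain ⟨⟨n, hn⟩, hget⟩ := List.mem_iff_get.mp ha'
  have hn' : n < L.card := by rwa [Finset.length_toList] at hn
  have hn2 : ¬ (L.card + n < L.card) := by omega
  have := @Step.choice (2 * L.card - 1) (fun i =>
        if h : (i : ℕ) < L.card then
          Act.inp (L.toList.get ⟨(i : ℕ), by rw [Finset.length_toList]; exact h⟩)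
        else
          Act.out (L.toList.get ⟨(i : ℕ) - L.card, by
            rw [Finset.length_toList]
            have hc : 0 < L.card :=
              Finset.card_pos.mpr (Finset.nonempty_iff_ne_empty.mpr hL)
            have hi := i.isLt
            omega⟩)) (fun _ => Tm.prefix1 .omega .nil) ⟨L.card + n, by omega⟩
  simp only [dif_neg hn2, Nat.add_sub_cancel_left, hget] at this
  exact this

theorem obs_ne_W (L : Finset Chan) : obsO L ≠ W := by
  intro h
  have h1 : Step (obsO L) .omega (FinDist.dirac .nil) := by rw [h]; exact W_step
  exact (step_obs h1).1

theorem par_obs_tau {L : Finset Chan} {P : Tm} {R : FinDist Tm}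
    (h : Step (.par P (obsO L)) .tau R) :
    (∃ ρ, Step P .tau ρ ∧ R = ρ.parD (FinDist.dirac (obsO L))) ∨
    (P ∈ psiL ∧ ∃ α ρ, Step P α ρ ∧ R = ρ.parD (FinDist.dirac W)) := by
  cases h with
  | parL _ hs => exact .inl ⟨_, hs, rfl⟩
  | parR _ hs => exact absurd (step_obs hs).1 (by simp [Act.IsLabel])
  | comm hc hs ht =>
    right
    obtain ⟨_, rfl⟩ := step_obs ht
    refine ⟨⟨_, _, ?_, hs⟩, _, _, hs, rfl⟩
    obtain ⟨a, ⟨rfl, _⟩ | ⟨rfl, _⟩⟩ := hc <;> trivial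

theorem par_W_tau {P : Tm} {R : FinDist Tm} (h : Step (.par P W) .tau R) :
    ∃ ρ, Step P .tau ρ ∧ R = ρ.parD (FinDist.dirac W) := by
  cases h with
  | parL _ hs => exact ⟨_, hs, rfl⟩
  | parR _ hs => exact absurd (step_W hs) (by simp)
  | comm hc hs ht =>
    have := step_W ht
    obtain ⟨a, ⟨_, rfl⟩ | ⟨_, rfl⟩⟩ := hc <;> simp at this

theorem par_obs_comm {L : Finset Chan} {P : Tm} (hg : Good L P) (hP : P ∈ psiL) :
    ∃ α ρ, Step P α ρ ∧ Step (.par P (obsO L)) .tau (ρ.parD (FinDist.dirac W)) := by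
  obtain ⟨α, ρ, hα, hs⟩ := hP
  have hch := (good_step hs hg).2.1
  refine ⟨α, ρ, hs, ?_⟩
  cases α with
  | inp a =>
    exact Step.comm ⟨a, .inl ⟨rfl, rfl⟩⟩ hs (obs_out (hch (by simp [Act.chans])))
  | out a =>
    exact Step.comm ⟨a, .inr ⟨rfl, rfl⟩⟩ hs (obs_inp (hch (by simp [Act.chans])))
  | tau => exact hα.elim
  | omega => exact hα.elim

theorem par_obs_omega {L : Finset Chan} {P : Tm} (hg : Good L P) :
    Tm.par P (obsO L) ∉ psiOmega := by
  rintro ⟨ρ, h⟩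
  cases h with
  | parL _ hs => exact (good_step hs hg).1 rfl
  | parR _ hs => exact (step_obs hs).1

theorem par_W_omega (P : Tm) : Tm.par P W ∈ psiOmega := ⟨_, Step.parR P W_step⟩

/-! ### The invariant -/

def Shape (L : Finset Chan) (ν' : FinDist Tm) : Prop :=
  ∀ R, ν'.toFun R ≠ 0 → ∃ P, Good L P ∧ (R = .par P (obsO L) ∨ R = .par P W)

structure Inv (L : Finset Chan) (S : Set Tm) (ν' ν : FinDist Tm) : Prop where
  shape : Shape L ν'
  le : ∀ Q, ν'.toFun (.par Q (obsO L)) ≤ ν.toFun Q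
  eq : ∀ Q, Q ∉ S → ν'.toFun (.par Q (obsO L)) = ν.toFun Q

theorem Inv.mono {L : Finset Chan} {S S' : Set Tm} {ν' ν : FinDist Tm} (h : Inv L S ν' ν)
    (hS : S ⊆ S') : Inv L S' ν' ν :=
  ⟨h.shape, h.le, fun Q hQ => h.eq Q fun hc => hQ (hS hc)⟩

theorem Shape.good {L : Finset Chan} {ν' : FinDist Tm} (h : Shape L ν') {P : Tm}
    (hP : ν'.toFun (.par P (obsO L)) ≠ 0) : Good L P := by
  obtain ⟨P', hg, h1 | h1⟩ := h _ hP
  · cases h1; exact hg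
  · simp only [Tm.par.injEq] at h1
    exact absurd h1.2 (obs_ne_W L)

theorem shape_parD {L : Finset Chan} {ρ : FinDist Tm} {T : Tm} (hT : T = obsO L ∨ T = W)
    (hρ : ∀ Q, ρ.toFun Q ≠ 0 → Good L Q) : Shape L (ρ.parD (FinDist.dirac T)) := by
  intro R hR
  obtain ⟨A, B, rfl, hA, hB⟩ := parD_ne hR
  rw [dirac_ne hB]
  exact ⟨A, hρ A hA, by rcases hT with rfl | rfl <;> simp⟩

theorem shape_step {L : Finset Chan} {ν' τ' R' : FinDist Tm} {R : Tm} {p : ℝ}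
    (h : Shape L ν') (hR' : Shape L R') (hR : ν'.toFun R ≠ 0)
    (hτ : ∀ Q, τ'.toFun Q = ν'.toFun Q + ν'.toFun R * p *
      (R'.toFun Q - (if Q = R then 1 else 0))) : Shape L τ' := by
  intro Q hQ
  by_cases h1 : ν'.toFun Q = 0
  · by_cases h2 : R'.toFun Q = 0
    · exfalso
      have h3 : Q ≠ R := by rintro rfl; exact hR h1
      apply hQ
      rw [hτ, h1, h2, if_neg h3]
      ring
    · exact hR' Q h2
  · exact h Q h1

theorem par_obs_self (L : Finset Chan) (ρ : FinDist Tm) (Q : Tm) :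
    (ρ.parD (FinDist.dirac (obsO L))).toFun (.par Q (obsO L)) = ρ.toFun Q := by
  rw [parD_par, dirac_self, mul_one]

theorem par_W_obs (L : Finset Chan) (ρ : FinDist Tm) (Q : Tm) :
    (ρ.parD (FinDist.dirac W)).toFun (.par Q (obsO L)) = 0 := by
  rw [parD_par, dirac_other (obs_ne_W L), mul_zero]

theorem fwd_step {L : Finset Chan} {S : Set Tm} (hS : S = ∅ ∨ S = Set.univ)
    {ν' ν τ : FinDist Tm} (h : Inv L S ν' ν) (hst : TStep ν τ) :
    ∃ τ', Relation.ReflTransGen TStep ν' τ' ∧ Inv L S τ' τ := by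
  obtain ⟨p, hp, hp1, P, ρ, hP, hs, hτ⟩ := hst
  by_cases h0 : ν'.toFun (.par P (obsO L)) = 0
  · refine ⟨ν', .refl, h.shape, fun Q => ?_, fun Q hQ => ?_⟩
    · rw [hτ]
      by_cases hQ : Q = P
      · subst hQ
        rw [h0, if_pos rfl]
        have := ρ.nonneg Q
        nlinarith [mul_nonneg (mul_nonneg hP.le hp.le) this,
          mul_nonneg hP.le (sub_nonneg.mpr hp1)]
      · rw [if_neg hQ, sub_zero]
        have := mul_nonneg (mul_nonneg hP.le hp.le) (ρ.nonneg Q)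
        linarith [h.le Q]
    · rcases hS with rfl | rfl
      · have := h.eq P (by simp)
        linarith
      · simp at hQ
  · have hg := h.shape.good h0
    have hpos : 0 < ν'.toFun (.par P (obsO L)) := lt_of_le_of_ne (ν'.nonneg _) (Ne.symm h0)
    have hgs := good_step hs hg
    set R' := ρ.parD (FinDist.dirac (obsO L)) with hR'
    have hval : ∀ Q, (upd ν' (.par P (obsO L)) p hp.le hp1 R').toFun (.par Q (obsO L)) =
        ν'.toFun (.par Q (obsO L)) + ν'.toFun (.par P (obsO L)) * p *
          (ρ.toFun Q - (if Q = P then 1 else 0)) := by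
      intro Q
      simp only [upd, hR', par_obs_self, Tm.par.injEq, and_true]
    refine ⟨upd ν' (.par P (obsO L)) p hp.le hp1 R',
      .single ⟨p, hp, hp1, _, R', hpos, Step.parL _ hs, fun _ => rfl⟩,
      shape_step h.shape (shape_parD (.inl rfl) hgs.2.2) h0 (fun _ => rfl),
      fun Q => ?_, fun Q hQ => ?_⟩
    · rw [hval, hτ]
      by_cases hQ : Q = P
      · subst hQ
        rw [if_pos rfl]
        have h1 := ρ.nonneg Q
        have h2 := h.le Q
        nlinarith [mul_nonneg (mul_nonneg (sub_nonneg.mpr h2) hp.le) h1,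
          mul_nonneg (sub_nonneg.mpr h2) (sub_nonneg.mpr hp1)]
      · rw [if_neg hQ, sub_zero]
        have h1 := ρ.nonneg Q
        have h2 := h.le P
        nlinarith [mul_nonneg (mul_nonneg (sub_nonneg.mpr h2) hp.le) h1, h.le Q]
    · rcases hS with rfl | rfl
      · rw [hval, hτ, h.eq P (by simp), h.eq Q (by simp)]
      · simp at hQ

theorem fwd {L : Finset Chan} {S : Set Tm} (hS : S = ∅ ∨ S = Set.univ)
    {ν' ν τ : FinDist Tm} (h : Inv L S ν' ν) (hst : Relation.ReflTransGen TStep ν τ) :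
    ∃ τ', Relation.ReflTransGen TStep ν' τ' ∧ Inv L S τ' τ := by
  induction hst with
  | refl => exact ⟨ν', .refl, h⟩
  | tail _ hs ih =>
    obtain ⟨σ', h1, h2⟩ := ih
    obtain ⟨τ', h3, h4⟩ := fwd_step hS h2 hs
    exact ⟨τ', h1.trans h3, h4⟩

theorem bwd_step {L : Finset Chan} {ν' ν τ' : FinDist Tm} (h : Inv L psiL ν' ν)
    (hst : TStep ν' τ') :
    ∃ τ, Relation.ReflTransGen TStep ν τ ∧ Inv L psiL τ' τ := by
  obtain ⟨p, hp, hp1, R, R', hR, hs, hτ⟩ := hst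
  obtain ⟨P, hg, rfl | rfl⟩ := h.shape R hR.ne'
  · rcases par_obs_tau hs with ⟨ρ, hsP, rfl⟩ | ⟨hP, α, ρ, hsP, rfl⟩
    · have hb : 0 < ν.toFun P := lt_of_lt_of_le hR (h.le P)
      set a := ν'.toFun (.par P (obsO L)) with ha
      have hp' : 0 < a / ν.toFun P * p := by positivity
      have hp1' : a / ν.toFun P * p ≤ 1 := by
        have : a / ν.toFun P ≤ 1 := (div_le_one hb).mpr (h.le P)
        have h0 : 0 ≤ a / ν.toFun P := by positivity
        nlinarith
      have hval : ∀ Q, (upd ν P _ hp'.le hp1' ρ).toFun Q - ν.toFun Q =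
          τ'.toFun (.par Q (obsO L)) - ν'.toFun (.par Q (obsO L)) := by
        intro Q
        rw [hτ]
        simp only [upd, par_obs_self, Tm.par.injEq, and_true]
        field_simp
        ring
      refine ⟨upd ν P _ hp'.le hp1' ρ, .single ⟨_, hp', hp1', P, ρ, hb, hsP, fun _ => rfl⟩,
        shape_step h.shape (shape_parD (.inl rfl) (good_step hsP hg).2.2) hR.ne' hτ,
        fun Q => ?_, fun Q hQ => ?_⟩
      · linarith [hval Q, h.le Q]
      · linarith [hval Q, h.eq Q hQ]
    · refine ⟨ν, .refl,
        shape_step h.shape (shape_parD (.inr rfl) (good_step hsP hg).2.2) hR.ne' hτ,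
        fun Q => ?_, fun Q hQ => ?_⟩
      · rw [hτ, par_W_obs]
        have := mul_nonneg hR.le hp.le
        split_ifs <;> linarith [h.le Q]
      · rw [hτ, par_W_obs, if_neg, h.eq Q hQ]
        · ring
        · simp only [Tm.par.injEq, and_true]
          rintro rfl
          exact hQ hP
  · obtain ⟨ρ, hsP, rfl⟩ := par_W_tau hs
    have hval : ∀ Q, τ'.toFun (.par Q (obsO L)) = ν'.toFun (.par Q (obsO L)) := by
      intro Q
      rw [hτ, par_W_obs, if_neg]
      · ring
      · simp only [Tm.par.injEq, not_and]
        exact fun _ => obs_ne_W L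
    exact ⟨ν, .refl,
        shape_step h.shape (shape_parD (.inr rfl) (good_step hsP hg).2.2) hR.ne' hτ,
        fun Q => by rw [hval]; exact h.le Q, fun Q hQ => by rw [hval]; exact h.eq Q hQ⟩

theorem bwd {L : Finset Chan} {ν' ν τ' : FinDist Tm} (h : Inv L psiL ν' ν)
    (hst : Relation.ReflTransGen TStep ν' τ') :
    ∃ τ, Relation.ReflTransGen TStep ν τ ∧ Inv L psiL τ' τ := by
  induction hst with
  | refl => exact ⟨ν, .refl, h⟩
  | tail _ hs ih =>
    obtain ⟨σ, h1, h2⟩ := ih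
    obtain ⟨τ, h3, h4⟩ := bwd_step h2 hs
    exact ⟨τ, h1.trans h3, h4⟩

theorem start {L : Finset Chan} {μ : FinDist Tm} (hμ : μ.IsProcDist) (hL : μ.chansIn L) :
    Inv L ∅ (μ.parD (FinDist.dirac (obsO L))) μ :=
  ⟨shape_parD (.inl rfl) fun Q hQ => ⟨(hμ Q hQ).2, hL Q hQ⟩,
    fun Q => (par_obs_self L μ Q).le, fun Q _ => par_obs_self L μ Q⟩

/-- Flush all observable processes in `F` into the success state. -/
theorem flush {L : Finset Chan} {ν' ν : FinDist Tm} (h : Inv L Set.univ ν' ν) (F : Finset Tm) :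
    (∀ Q ∈ F, Q ∈ psiL) → ∃ τ', Relation.ReflTransGen TStep ν' τ' ∧ Inv L Set.univ τ' ν ∧
      ∀ Q ∈ F, τ'.toFun (.par Q (obsO L)) = 0 := by
  induction F using Finset.induction_on with
  | empty => intro _; exact ⟨ν', .refl, h, by simp⟩
  | insert P F hPF ih =>
    intro hF
    obtain ⟨σ', h1, h2, h3⟩ := ih fun Q hQ => hF Q (Finset.mem_insert_of_mem hQ)
    by_cases h0 : σ'.toFun (.par P (obsO L)) = 0
    · refine ⟨σ', h1, h2, fun Q hQ => ?_⟩
      rcases Finset.mem_insert.mp hQ with rfl | hQ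
      · exact h0
      · exact h3 Q hQ
    · have hg := h2.shape.good h0
      have hpos : 0 < σ'.toFun (.par P (obsO L)) := lt_of_le_of_ne (σ'.nonneg _) (Ne.symm h0)
      obtain ⟨α, ρ, hsP, hs⟩ := par_obs_comm hg (hF P (Finset.mem_insert_self _ _))
      set τ' := upd σ' (.par P (obsO L)) 1 zero_le_one le_rfl (ρ.parD (FinDist.dirac W)) with hτ'
      have hval : ∀ Q, τ'.toFun (.par Q (obsO L)) =
          if Q = P then 0 else σ'.toFun (.par Q (obsO L)) := by
        intro Q
        simp only [hτ', upd, par_W_obs, Tm.par.injEq, and_true]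
        split_ifs with hQ
        · subst hQ; ring
        · ring
      refine ⟨τ', h1.tail ⟨1, one_pos, le_rfl, _, _, hpos, hs, fun _ => rfl⟩,
        ⟨shape_step h2.shape (shape_parD (.inr rfl) (good_step hsP hg).2.2) h0 (fun _ => rfl),
          fun Q => ?_, fun Q hQ => by simp at hQ⟩, fun Q hQ => ?_⟩
      · rw [hval]
        split_ifs
        · exact ν.nonneg Q
        · exact h2.le Q
      · rw [hval]
        split_ifs with hQP
        · rfl
        · exact h3 Q (Finset.mem_of_mem_insert_of_ne hQ hQP)

/-! ### Masses -/

theorem finsum_le {f g : Tm → ℝ} (hf : (Function.support f).Finite)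
    (hg : (Function.support g).Finite) (h : ∀ Q, f Q ≤ g Q) : ∑ᶠ Q, f Q ≤ ∑ᶠ Q, g Q := by
  have h1 := finsum_sub_distrib hg hf
  have h2 : 0 ≤ ∑ᶠ Q, (g Q - f Q) := finsum_nonneg fun Q => sub_nonneg.mpr (h Q)
  linarith

theorem mass_indicator (ν : FinDist Tm) (φ : Set Tm) :
    ν.mass φ = ∑ᶠ Q, φ.indicator ν.toFun Q := finsum_mem_def φ ν.toFun

theorem fin_ind (ν : FinDist Tm) (φ : Set Tm) :
    (Function.support (φ.indicator ν.toFun)).Finite :=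
  ν.finite_support.subset (by rw [Set.support_indicator]; exact Set.inter_subset_right)

theorem mass_compl (ν : FinDist Tm) (φ : Set Tm) : ν.mass φ = 1 - ν.mass φᶜ := by
  rw [mass_indicator, mass_indicator, eq_sub_iff_add_eq,
    ← finsum_add_distrib (fin_ind ν φ) (fin_ind ν φᶜ), ← ν.sum_one]
  refine finsum_congr fun Q => ?_
  exact congrFun (Set.indicator_self_add_compl φ ν.toFun) Q

theorem mass_nonneg (ν : FinDist Tm) (φ : Set Tm) : 0 ≤ ν.mass φ := by
  rw [mass_indicator]
  exact finsum_nonneg fun Q => Set.indicator_nonneg (fun a _ => ν.nonneg a) Q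

theorem mass_le_one (ν : FinDist Tm) (φ : Set Tm) : ν.mass φ ≤ 1 := by
  rw [mass_compl]
  linarith [mass_nonneg ν φᶜ]

theorem fin_obs (L : Finset Chan) (ν' : FinDist Tm) :
    (Function.support fun Q => ν'.toFun (.par Q (obsO L))).Finite := by
  have : (Function.support fun Q => ν'.toFun (.par Q (obsO L))) =
      (fun Q => Tm.par Q (obsO L)) ⁻¹' (Function.support ν'.toFun) := rfl
  rw [this]
  refine ν'.finite_support.preimage ?_
  intro A _ B _ hAB
  simpa using hAB

theorem mass_omega {L : Finset Chan} {ν' : FinDist Tm} (h : Shape L ν') :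
    ν'.mass psiOmega = 1 - ∑ᶠ Q, ν'.toFun (.par Q (obsO L)) := by
  rw [mass_compl]
  congr 1
  have hinj : Function.Injective fun Q => Tm.par Q (obsO L) := by
    intro A B hAB
    simpa using hAB
  rw [← finsum_mem_range (f := ν'.toFun) hinj]
  refine finsum_mem_inter_support_eq _ _ _ ?_
  ext R
  simp only [Set.mem_inter_iff, Set.mem_compl_iff, Function.mem_support, Set.mem_range,
    and_congr_left_iff]
  intro hR
  obtain ⟨P, hg, rfl | rfl⟩ := h R hR
  · exact ⟨fun _ => ⟨P, rfl⟩, fun _ => par_obs_omega hg⟩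
  · constructor
    · intro hc; exact absurd (par_W_omega P) hc
    · rintro ⟨y, hy⟩
      simp only [Tm.par.injEq] at hy
      exact absurd hy.2 (obs_ne_W L)

theorem end_bwd {L : Finset Chan} {ν' ν : FinDist Tm} (h : Inv L psiL ν' ν) :
    ν'.mass psiOmega ≤ ν.mass psiL := by
  rw [mass_omega h.shape, mass_compl ν, mass_indicator]
  have : ∑ᶠ Q, psiLᶜ.indicator ν.toFun Q ≤ ∑ᶠ Q, ν'.toFun (.par Q (obsO L)) := by
    refine finsum_le (fin_ind ν _) (fin_obs L ν') fun Q => ?_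
    by_cases hQ : Q ∈ psiL
    · rw [Set.indicator_of_notMem (by simpa using hQ)]
      exact ν'.nonneg _
    · rw [Set.indicator_of_mem (by simpa using hQ), h.eq Q hQ]
  linarith

theorem end_fwd {L : Finset Chan} {ν' ν : FinDist Tm} (h : Inv L Set.univ ν' ν) :
    ∃ τ', Relation.ReflTransGen TStep ν' τ' ∧ ν.mass psiL ≤ τ'.mass psiOmega := by
  obtain ⟨τ', h1, h2, h3⟩ := flush h (ν.finite_support.toFinset.filter (· ∈ psiL)) (by simp)
  refine ⟨τ', h1, ?_⟩
  rw [mass_omega h2.shape, mass_compl ν, mass_indicator]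
  have : ∑ᶠ Q, τ'.toFun (.par Q (obsO L)) ≤ ∑ᶠ Q, psiLᶜ.indicator ν.toFun Q := by
    refine finsum_le (fin_obs L τ') (fin_ind ν _) fun Q => ?_
    by_cases hQ : Q ∈ psiL
    · rw [Set.indicator_of_notMem (by simpa using hQ)]
      by_cases h0 : ν.toFun Q = 0
      · exact (h2.le Q).trans h0.le
      · exact (h3 Q (by simp [h0, hQ])).le
    · rw [Set.indicator_of_mem (by simpa using hQ)]
      exact h2.le Q
  linarith

/-! ### Characteristics -/

theorem bdd_mass (μ : FinDist Tm) (φ : Set Tm) :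
    BddAbove {x | ∃ ν, Internal μ ν ∧ x = ν.mass φ} :=
  ⟨1, by rintro x ⟨ν, _, rfl⟩; exact mass_le_one ν φ⟩

theorem refl_internal (μ : FinDist Tm) : Internal μ μ := internal_iff.mpr .refl

theorem may_le {L : Finset Chan} {ν' ν : FinDist Tm} (h : Inv L psiL ν' ν) :
    chiMayOmega ν' ≤ chiMayL ν := by
  refine csSup_le ⟨_, ν', refl_internal _, rfl⟩ ?_
  rintro x ⟨τ', hτ', rfl⟩
  obtain ⟨τ, h1, h2⟩ := bwd h (internal_iff.mp hτ')
  exact (end_bwd h2).trans (le_csSup (bdd_mass ν psiL) ⟨τ, internal_iff.mpr h1, rfl⟩)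

theorem le_may {L : Finset Chan} {ν' ν : FinDist Tm} (h : Inv L Set.univ ν' ν) :
    chiMayL ν ≤ chiMayOmega ν' := by
  refine csSup_le ⟨_, ν, refl_internal _, rfl⟩ ?_
  rintro x ⟨τ, hτ, rfl⟩
  obtain ⟨τ', h1, h2⟩ := fwd (.inr rfl) h (internal_iff.mp hτ)
  obtain ⟨σ', h3, h4⟩ := end_fwd h2
  exact h4.trans (le_csSup (bdd_mass ν' psiOmega) ⟨σ', internal_iff.mpr (h1.trans h3), rfl⟩)

theorem mayL_nonneg (μ : FinDist Tm) : 0 ≤ chiMayL μ :=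
  (mass_nonneg μ psiL).trans (le_csSup (bdd_mass μ psiL) ⟨μ, refl_internal _, rfl⟩)

theorem mayOmega_nonneg (μ : FinDist Tm) : 0 ≤ chiMayOmega μ :=
  (mass_nonneg μ psiOmega).trans (le_csSup (bdd_mass μ psiOmega) ⟨μ, refl_internal _, rfl⟩)

end ObsProof

/-- Testing against the observer `o_L = δ_{O_L}` computes the
model-independent characteristics: `χmay_ω(μ | o_L) = χmay_𝓛(μ)` and
`χfair_ω(μ | o_L) = χfair_𝓛(μ)`. -/
theorem external_characteristics_via_obsO
    (μ : FinDist Tm) (hμ : μ.IsProcDist)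
    (L : Finset Chan) (hL : μ.chansIn L) :
    chiMayOmega (μ.parD (FinDist.dirac (obsO L))) = chiMayL μ ∧
    chiFairOmega (μ.parD (FinDist.dirac (obsO L))) = chiFairL μ := by
  have h0 := ObsProof.start hμ hL
  refine ⟨le_antisymm (ObsProof.may_le (h0.mono (Set.empty_subset _)))
    (ObsProof.le_may (h0.mono (Set.empty_subset _))), le_antisymm ?_ ?_⟩
  · refine le_csInf ⟨_, μ, ObsProof.refl_internal _, rfl⟩ ?_
    rintro x ⟨ν, hν, rfl⟩
    obtain ⟨ν', h1, h2⟩ := ObsProof.fwd (.inl rfl) h0 (ObsProof.internal_iff.mp hν)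
    refine le_trans (csInf_le ⟨0, ?_⟩ ⟨ν', ObsProof.internal_iff.mpr h1, rfl⟩)
      (ObsProof.may_le (h2.mono (Set.empty_subset _)))
    rintro y ⟨τ, _, rfl⟩
    exact ObsProof.mayOmega_nonneg τ
  · refine le_csInf ⟨_, _, ObsProof.refl_internal _, rfl⟩ ?_
    rintro x ⟨ν', hν', rfl⟩
    obtain ⟨ν, h1, h2⟩ := ObsProof.bwd (h0.mono (Set.empty_subset _))
      (ObsProof.internal_iff.mp hν')
    refine le_trans (csInf_le ⟨0, ?_⟩ ⟨ν, ObsProof.internal_iff.mpr h1, rfl⟩)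
      (ObsProof.le_may (h2.mono (Set.subset_univ _)))
    rintro y ⟨τ, _, rfl⟩
    exact ObsProof.mayL_nonneg τ
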